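/- arXiv:1901.06665 — 2 statements merged into one kernel-verified Lean document; each statement's English description precedes it below -/
import Mathlib

section
/- Let L : 𝔰 × 𝔰 → ℝ³ be an ℝ-bilinear map satisfying L(q S qᵀ, q T qᵀ) = (det q) · q (L(S, T)) for all q ∈ O(3) and S, T ∈ 𝔰. Then there exists c ∈ ℝ such that L(S, T) = c · ★(S T − T S) for all S, T ∈ 𝔰 (note that S T − T S is skew-symmetric for symmetric S, T). -/
open Matrix

/-- The map `★`, inverse of the hat map, defined on skew-symmetric 3×3 matrices
(and extended to all matrices by reading off the relevant entries). -/
def starM (A : Matrix (Fin 3) (Fin 3) ℝ) : Fin 3 → ℝ := ![A 2 1, A 0 2, A 1 0]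

namespace TracelessSymmetric

/-- `starM` as a linear map. -/
def starLinear : Matrix (Fin 3) (Fin 3) ℝ →ₗ[ℝ] (Fin 3 → ℝ) where
  toFun := starM
  map_add' A B := by ext k; fin_cases k <;> simp [starM]
  map_smul' c A := by ext k; fin_cases k <;> simp [starM]

/-- Two diagonal and three off-diagonal matrices spanning the symmetric traceless matrices. -/
def basis : Fin 5 → Matrix (Fin 3) (Fin 3) ℝ :=
  ![!![1, 0, 0; 0, -1, 0; 0, 0, 0], !![0, 0, 0; 0, 1, 0; 0, 0, -1],
    !![0, 0, 0; 0, 0, 1; 0, 1, 0], !![0, 0, 1; 0, 0, 0; 1, 0, 0],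
    !![0, 1, 0; 1, 0, 0; 0, 0, 0]]

theorem basis_transpose (i : Fin 5) : (basis i)ᵀ = basis i := by
  fin_cases i <;> ext j k <;> fin_cases j <;> fin_cases k <;> simp [basis]

theorem basis_trace (i : Fin 5) : (basis i).trace = 0 := by
  fin_cases i <;> simp [basis, Matrix.trace, Fin.sum_univ_three]

theorem eq_sum_basis {S : Matrix (Fin 3) (Fin 3) ℝ} (hS : Sᵀ = S) (hS' : S.trace = 0) :
    S = ∑ i, ![S 0 0, S 0 0 + S 1 1, S 1 2, S 0 2, S 0 1] i • basis i := by
  have h1 : S 1 0 = S 0 1 := congrFun (congrFun hS 0) 1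
  have h2 : S 2 0 = S 0 2 := congrFun (congrFun hS 0) 2
  have h3 : S 2 1 = S 1 2 := congrFun (congrFun hS 1) 2
  simp only [Matrix.trace, Fin.sum_univ_three, Matrix.diag_apply] at hS'
  rw [Fin.sum_univ_five]
  ext j k
  fin_cases j <;> fin_cases k <;> simp [basis, h1, h2, h3]
  linarith

/-- The half-turn about the first axis. -/
def halfTurnX : Matrix (Fin 3) (Fin 3) ℝ := diagonal ![1, -1, -1]

/-- The half-turn about the second axis. -/
def halfTurnY : Matrix (Fin 3) (Fin 3) ℝ := diagonal ![-1, 1, -1]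

/-- The cyclic permutation of the coordinate axes. -/
def cycle : Matrix (Fin 3) (Fin 3) ℝ := !![0, 0, 1; 1, 0, 0; 0, 1, 0]

/-- A rotation about the third axis with rational entries. -/
noncomputable def tilt : Matrix (Fin 3) (Fin 3) ℝ := !![3/5, -4/5, 0; 4/5, 3/5, 0; 0, 0, 1]

/-- The matrix of conjugation by `halfTurnX` in `basis`, one row for each basis vector. -/
def halfTurnXAction : Matrix (Fin 5) (Fin 5) ℝ :=
  diagonal ![1, 1, 1, -1, -1]

theorem halfTurnX_orthogonal : halfTurnXᵀ * halfTurnX = 1 := by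
  ext j k
  fin_cases j <;> fin_cases k <;> simp [halfTurnX, Matrix.mul_apply, Fin.sum_univ_three]

theorem halfTurnX_det : halfTurnX.det = 1 := by
  simp [halfTurnX, Fin.prod_univ_three]

theorem halfTurnX_conj (i : Fin 5) : halfTurnX * basis i * halfTurnXᵀ =
    ∑ m, halfTurnXAction i m • basis m := by
  rw [Fin.sum_univ_five]
  fin_cases i <;> ext j k <;> fin_cases j <;> fin_cases k <;>
    simp [halfTurnX, halfTurnXAction, basis, Matrix.mul_apply, Fin.sum_univ_three]

/-- The matrix of conjugation by `halfTurnY` in `basis`, one row for each basis vector. -/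
def halfTurnYAction : Matrix (Fin 5) (Fin 5) ℝ :=
  diagonal ![1, 1, -1, 1, -1]

theorem halfTurnY_orthogonal : halfTurnYᵀ * halfTurnY = 1 := by
  ext j k
  fin_cases j <;> fin_cases k <;> simp [halfTurnY, Matrix.mul_apply, Fin.sum_univ_three]

theorem halfTurnY_det : halfTurnY.det = 1 := by
  simp [halfTurnY, Fin.prod_univ_three]

theorem halfTurnY_conj (i : Fin 5) : halfTurnY * basis i * halfTurnYᵀ =
    ∑ m, halfTurnYAction i m • basis m := by
  rw [Fin.sum_univ_five]
  fin_cases i <;> ext j k <;> fin_cases j <;> fin_cases k <;>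
    simp [halfTurnY, halfTurnYAction, basis, Matrix.mul_apply, Fin.sum_univ_three]

/-- The matrix of conjugation by `cycle` in `basis`, one row for each basis vector. -/
def cycleAction : Matrix (Fin 5) (Fin 5) ℝ :=
  !![0, 1, 0, 0, 0; -1, -1, 0, 0, 0; 0, 0, 0, 1, 0; 0, 0, 0, 0, 1; 0, 0, 1, 0, 0]

theorem cycle_orthogonal : cycleᵀ * cycle = 1 := by
  ext j k
  fin_cases j <;> fin_cases k <;> simp [cycle, Matrix.mul_apply, Fin.sum_univ_three]

theorem cycle_det : cycle.det = 1 := by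
  simp [cycle, Matrix.det_fin_three]

theorem cycle_conj (i : Fin 5) : cycle * basis i * cycleᵀ = ∑ m, cycleAction i m • basis m := by
  rw [Fin.sum_univ_five]
  fin_cases i <;> ext j k <;> fin_cases j <;> fin_cases k <;>
    simp [cycle, cycleAction, basis, Matrix.mul_apply, Fin.sum_univ_three]

/-- The matrix of conjugation by `tilt` in `basis`, one row for each basis vector. -/
noncomputable def tiltAction : Matrix (Fin 5) (Fin 5) ℝ :=
  !![-7/25, 0, 0, 0, 24/25; 16/25, 1, 0, 0, -12/25; 0, 0, 3/5, -4/5, 0;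
    0, 0, 4/5, 3/5, 0; -24/25, 0, 0, 0, -7/25]

theorem tilt_orthogonal : tiltᵀ * tilt = 1 := by
  ext j k
  fin_cases j <;> fin_cases k <;> simp [tilt, Matrix.mul_apply, Fin.sum_univ_three] <;> norm_num

theorem tilt_det : tilt.det = 1 := by
  simp [tilt, Matrix.det_fin_three]
  norm_num

theorem tilt_conj (i : Fin 5) : tilt * basis i * tiltᵀ = ∑ m, tiltAction i m • basis m := by
  rw [Fin.sum_univ_five]
  fin_cases i <;> ext j k <;> fin_cases j <;> fin_cases k <;>
    simp [tilt, tiltAction, basis, Matrix.mul_apply, Fin.sum_univ_three] <;> norm_num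

/-- A bilinear map equivariant under a rotation has structure constants invariant under it. -/
theorem structureConstants_invariant
    (L : Matrix (Fin 3) (Fin 3) ℝ →ₗ[ℝ] Matrix (Fin 3) (Fin 3) ℝ →ₗ[ℝ] (Fin 3 → ℝ))
    (hL : ∀ q : Matrix (Fin 3) (Fin 3) ℝ, qᵀ * q = 1 →
      ∀ S T : Matrix (Fin 3) (Fin 3) ℝ, Sᵀ = S → S.trace = 0 → Tᵀ = T → T.trace = 0 →
        L (q * S * qᵀ) (q * T * qᵀ) = q.det • q.mulVec (L S T))
    {q : Matrix (Fin 3) (Fin 3) ℝ} (hq : qᵀ * q = 1) (hd : q.det = 1)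
    {r : Matrix (Fin 5) (Fin 5) ℝ} (hr : ∀ i, q * basis i * qᵀ = ∑ m, r i m • basis m)
    (i j : Fin 5) (k : Fin 3) :
    ∑ m, ∑ n, r i m * (r j n * L (basis m) (basis n) k) =
      ∑ l, q k l * L (basis i) (basis j) l := by
  have h := congrFun (hL q hq _ _ (basis_transpose i) (basis_trace i) (basis_transpose j)
    (basis_trace j)) k
  rw [hr, hr, hd, one_smul] at h
  simp only [map_sum, map_smul, LinearMap.sum_apply, LinearMap.smul_apply, Finset.sum_apply,
    Pi.smul_apply, smul_eq_mul, Matrix.mulVec, dotProduct, Finset.mul_sum] at h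
  rw [← h, Finset.sum_comm]
  exact Finset.sum_congr rfl fun n _ => Finset.sum_congr rfl fun m _ => by ring

/-- The index of the only coordinate in which a map commuting with the half-turns can be nonzero on
a pair of basis elements; the value `3` means that there is none. -/
def weight : Fin 5 → Fin 5 → ℕ :=
  ![![3, 3, 0, 1, 2], ![3, 3, 0, 1, 2], ![0, 0, 3, 2, 1], ![1, 1, 2, 3, 0], ![2, 2, 1, 0, 3]]

theorem eq_zero_or_weight_eq (f : Fin 5 → Fin 5 → Fin 3 → ℝ)
    (hX : ∀ i j k, ∑ m, ∑ n, halfTurnXAction i m * (halfTurnXAction j n * f m n k) =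
      ∑ l, halfTurnX k l * f i j l)
    (hY : ∀ i j k, ∑ m, ∑ n, halfTurnYAction i m * (halfTurnYAction j n * f m n k) =
      ∑ l, halfTurnY k l * f i j l) (i j : Fin 5) (k : Fin 3) :
    f i j k = 0 ∨ weight i j = k := by
  simp only [halfTurnX, halfTurnXAction, diagonal_apply, ite_mul, zero_mul, Finset.sum_ite_eq,
    Finset.mem_univ, if_true, mul_ite, mul_zero] at hX
  simp only [halfTurnY, halfTurnYAction, diagonal_apply, ite_mul, zero_mul, Finset.sum_ite_eq,
    Finset.mem_univ, if_true, mul_ite, mul_zero] at hY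
  specialize hX i j k
  specialize hY i j k
  fin_cases i <;> fin_cases j <;> fin_cases k <;>
    first
    | (right; rfl)
    | (left; simp at hX hY ⊢; linarith)

set_option maxHeartbeats 1000000 in
/-- Structure constants invariant under the four rotations are those of a multiple of the
commutator. -/
theorem structureConstants_eq (f : Fin 5 → Fin 5 → Fin 3 → ℝ)
    (hX : ∀ i j k, ∑ m, ∑ n, halfTurnXAction i m * (halfTurnXAction j n * f m n k) =
      ∑ l, halfTurnX k l * f i j l)
    (hY : ∀ i j k, ∑ m, ∑ n, halfTurnYAction i m * (halfTurnYAction j n * f m n k) =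
      ∑ l, halfTurnY k l * f i j l)
    (hC : ∀ i j k, ∑ m, ∑ n, cycleAction i m * (cycleAction j n * f m n k) =
      ∑ l, cycle k l * f i j l)
    (hT : ∀ i j k, ∑ m, ∑ n, tiltAction i m * (tiltAction j n * f m n k) =
      ∑ l, tilt k l * f i j l) (i j : Fin 5) (k : Fin 3) :
    f i j k = -(f 0 4 2 / 2) * starM (basis i * basis j - basis j * basis i) k := by
  have w := eq_zero_or_weight_eq f hX hY
  clear hX hY
  simp only [cycle, cycleAction, Fin.sum_univ_three, Fin.sum_univ_five] at hC
  simp only [tilt, tiltAction, Fin.sum_univ_three, Fin.sum_univ_five] at hT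
  have z002 : f 0 0 2 = 0 := (w 0 0 2).resolve_right (by decide)
  have z012 : f 0 1 2 = 0 := (w 0 1 2).resolve_right (by decide)
  have z102 : f 1 0 2 = 0 := (w 1 0 2).resolve_right (by decide)
  have z442 : f 4 4 2 = 0 := (w 4 4 2).resolve_right (by decide)
  have z030 : f 0 3 0 = 0 := (w 0 3 0).resolve_right (by decide)
  have z420 : f 4 2 0 = 0 := (w 4 2 0).resolve_right (by decide)
  have z300 : f 3 0 0 = 0 := (w 3 0 0).resolve_right (by decide)
  have z240 : f 2 4 0 = 0 := (w 2 4 0).resolve_right (by decide)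
  have e40 : f 4 0 2 = -f 0 4 2 := by
    have h := hT 0 4 2
    simp [z002, z442] at h
    linarith only [h]
  have e14 : f 1 4 2 = -(f 0 4 2 / 2) := by
    have h := hT 1 4 2
    simp [z002, z102, z442, e40] at h
    linarith only [h]
  have e41 : f 4 1 2 = f 0 4 2 / 2 := by
    have h := hT 4 1 2
    simp [z002, z012, z442, e40] at h
    linarith only [h]
  have e12 : f 1 2 0 = f 0 4 2 := by
    have h := hC 0 4 0
    simp at h
    linarith only [h]
  have e13 : f 1 3 1 = -(f 0 4 2 / 2) := by
    have h := hC 1 3 2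
    simp [e14] at h
    linarith only [h]
  have e02 : f 0 2 0 = -(f 0 4 2 / 2) := by
    have h := hC 1 4 0
    simp [e12, e14] at h
    linarith only [h]
  have e03 : f 0 3 1 = -(f 0 4 2 / 2) := by
    have h := hC 0 3 2
    simp [e14] at h
    linarith only [h]
  have e21 : f 2 1 0 = -f 0 4 2 := by
    have h := hC 4 0 0
    simp [e40] at h
    linarith only [h]
  have e20 : f 2 0 0 = f 0 4 2 / 2 := by
    have h := hC 4 1 0
    simp [e21, e41] at h
    linarith only [h]
  have e30 : f 3 0 1 = f 0 4 2 / 2 := by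
    have h := hC 3 0 2
    simp [e41] at h
    linarith only [h]
  have e31 : f 3 1 1 = f 0 4 2 / 2 := by
    have h := hC 3 1 2
    simp [e40, e41] at h
    linarith only [h]
  have e43 : f 4 3 0 = f 0 4 2 / 2 := by
    have h := hT 0 3 0
    simp [z030, z420, e02, e03] at h
    linarith only [h]
  have e34 : f 3 4 0 = -(f 0 4 2 / 2) := by
    have h := hT 3 0 0
    simp [z240, z300, e20, e30] at h
    linarith only [h]
  have e23 : f 2 3 2 = -(f 0 4 2 / 2) := by
    have h := hC 2 3 0
    simp [e34] at h
    linarith only [h]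
  have e42 : f 4 2 1 = -(f 0 4 2 / 2) := by
    have h := hC 3 4 1
    simp [e34] at h
    linarith only [h]
  have e32 : f 3 2 2 = f 0 4 2 / 2 := by
    have h := hC 3 2 0
    simp [e43] at h
    linarith only [h]
  have e24 : f 2 4 1 = f 0 4 2 / 2 := by
    have h := hC 4 3 1
    simp [e43] at h
    linarith only [h]
  specialize w i j k
  fin_cases i <;> fin_cases j <;> fin_cases k <;>
    first
    | simpa [weight, basis, starM] using w
    | (simp [basis, starM, e40, e14, e41, e12, e13, e02, e03, e21, e20,
        e30, e31, e43, e34, e23, e42, e32, e24] <;> ring)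

end TracelessSymmetric

open TracelessSymmetric in
/-- Any bilinear map `L : 𝔰 × 𝔰 → ℝ³` satisfying `L(qSqᵀ, qTqᵀ) = (det q) · q L(S,T)` for
all orthogonal `q` is a scalar multiple of `(S, T) ↦ ★[S,T]`. -/
theorem stmt_4 (L : Matrix (Fin 3) (Fin 3) ℝ →ₗ[ℝ] Matrix (Fin 3) (Fin 3) ℝ →ₗ[ℝ] (Fin 3 → ℝ))
    (hL : ∀ q : Matrix (Fin 3) (Fin 3) ℝ, qᵀ * q = 1 →
      ∀ S T : Matrix (Fin 3) (Fin 3) ℝ, Sᵀ = S → S.trace = 0 → Tᵀ = T → T.trace = 0 →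
        L (q * S * qᵀ) (q * T * qᵀ) = q.det • q.mulVec (L S T)) :
    ∃ c : ℝ, ∀ S T : Matrix (Fin 3) (Fin 3) ℝ, Sᵀ = S → S.trace = 0 → Tᵀ = T → T.trace = 0 →
      L S T = c • starM (S * T - T * S) := by
  refine ⟨-(L (basis 0) (basis 4) 2 / 2), fun S T hS hS' hT hT' => ?_⟩
  let D := L - (-(L (basis 0) (basis 4) 2 / 2)) •
    (LinearMap.mul ℝ (Matrix (Fin 3) (Fin 3) ℝ) -
      (LinearMap.mul ℝ (Matrix (Fin 3) (Fin 3) ℝ)).flip).compr₂ starLinear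
  have hD : ∀ i j, D (basis i) (basis j) = 0 := by
    intro i j
    ext k
    exact sub_eq_zero.mpr <| structureConstants_eq (fun i j k => L (basis i) (basis j) k)
      (structureConstants_invariant L hL halfTurnX_orthogonal halfTurnX_det halfTurnX_conj)
      (structureConstants_invariant L hL halfTurnY_orthogonal halfTurnY_det halfTurnY_conj)
      (structureConstants_invariant L hL cycle_orthogonal cycle_det cycle_conj)
      (structureConstants_invariant L hL tilt_orthogonal tilt_det tilt_conj) i j k
  have h : D S T = 0 := by
    rw [eq_sum_basis hS hS', eq_sum_basis hT hT']
    simp only [map_sum, map_smul, LinearMap.sum_apply, LinearMap.smul_apply, hD, smul_zero,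
      Finset.sum_const_zero]
  exact sub_eq_zero.mp h
end

section
/- Let V be a linear subspace of sl(3,ℝ), the space of traceless real 3×3 matrices, such that q A qᵀ ∈ V for every A ∈ V and every q ∈ O(3). Then V equals {0}, or so(3) (the skew-symmetric 3×3 matrices), or 𝔰, or all of sl(3,ℝ). -/
open Matrix

/-- `sl(3,ℝ)`: the traceless real 3×3 matrices. -/
def sl3 : Submodule ℝ (Matrix (Fin 3) (Fin 3) ℝ) :=
  LinearMap.ker (Matrix.traceLinearMap (Fin 3) ℝ ℝ)

/-- `so(3)`: the skew-symmetric real 3×3 matrices. -/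
def so3 : Submodule ℝ (Matrix (Fin 3) (Fin 3) ℝ) where
  carrier := {A | Aᵀ = -A}
  add_mem' := by
    intro a b ha hb
    simp only [Set.mem_setOf_eq] at *
    rw [Matrix.transpose_add, ha, hb, neg_add]
  zero_mem' := by simp
  smul_mem' := by
    intro c a ha
    simp only [Set.mem_setOf_eq] at *
    rw [Matrix.transpose_smul, ha, smul_neg]

/-- `𝔰`: the symmetric traceless real 3×3 matrices. -/
def sTL : Submodule ℝ (Matrix (Fin 3) (Fin 3) ℝ) where
  carrier := {A | Aᵀ = A ∧ A.trace = 0}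
  add_mem' := by
    rintro a b ⟨ha1, ha2⟩ ⟨hb1, hb2⟩
    exact ⟨by rw [Matrix.transpose_add, ha1, hb1],
      by rw [Matrix.trace_add, ha2, hb2, add_zero]⟩
  zero_mem' := by simp
  smul_mem' := by
    rintro c a ⟨ha1, ha2⟩
    exact ⟨by rw [Matrix.transpose_smul, ha1], by rw [Matrix.trace_smul, ha2, smul_zero]⟩

/-- Stability of a space of matrices under conjugation by orthogonal matrices. -/
def IsOrthogonalInvariant (V : Submodule ℝ (Matrix (Fin 3) (Fin 3) ℝ)) : Prop :=
  ∀ A ∈ V, ∀ q : Matrix (Fin 3) (Fin 3) ℝ, qᵀ * q = 1 → q * A * qᵀ ∈ V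

theorem exists_perm_apply_zero_one {i j : Fin 3} (h : i ≠ j) :
    ∃ σ : Equiv.Perm (Fin 3), σ 0 = i ∧ σ 1 = j := by
  revert i j
  decide

namespace IsOrthogonalInvariant

variable {V : Submodule ℝ (Matrix (Fin 3) (Fin 3) ℝ)}

theorem submatrix_mem (hV : IsOrthogonalInvariant V) {A : Matrix (Fin 3) (Fin 3) ℝ}
    (hA : A ∈ V) (σ : Equiv.Perm (Fin 3)) : A.submatrix σ σ ∈ V := by
  have hq := hV A hA ((1 : Matrix (Fin 3) (Fin 3) ℝ).submatrix σ id) (by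
    rw [transpose_submatrix, submatrix_mul_equiv, transpose_one, one_mul, submatrix_id_id])
  convert hq using 1
  ext i j
  simp [Matrix.mul_apply, Matrix.one_apply]

theorem diagonal_conj_mem (hV : IsOrthogonalInvariant V) {A : Matrix (Fin 3) (Fin 3) ℝ}
    (hA : A ∈ V) (d : Fin 3 → ℝ) (hd : ∀ i, d i * d i = 1) :
    diagonal d * A * diagonal d ∈ V := by
  simpa using hV A hA (diagonal d) (by simp [hd])

theorem diagonal_diag_mem (hV : IsOrthogonalInvariant V) {A : Matrix (Fin 3) (Fin 3) ℝ}
    (hA : A ∈ V) : diagonal A.diag ∈ V := by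
  have h₀ := hV.diagonal_conj_mem hA ![-1, 1, 1] (by simp [Fin.forall_fin_succ])
  have h₁ := hV.diagonal_conj_mem hA ![1, -1, 1] (by simp [Fin.forall_fin_succ])
  have h₂ := hV.diagonal_conj_mem hA ![1, 1, -1] (by simp [Fin.forall_fin_succ])
  convert V.smul_mem (1 / 4 : ℝ) (V.add_mem (V.add_mem (V.add_mem hA h₀) h₁) h₂) using 1
  ext i j
  fin_cases i <;> fin_cases j <;> simp [Matrix.mul_diagonal, Matrix.diagonal_mul] <;> ring

theorem offDiag_mem (hV : IsOrthogonalInvariant V) {A : Matrix (Fin 3) (Fin 3) ℝ}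
    (hA : A ∈ V) : !![0, A 0 1, 0; A 1 0, 0, 0; 0, 0, 0] ∈ V := by
  have h₂ := hV.diagonal_conj_mem hA ![1, 1, -1] (by simp [Fin.forall_fin_succ])
  convert V.sub_mem (V.smul_mem (1 / 2 : ℝ) (V.add_mem hA h₂)) (hV.diagonal_diag_mem hA) using 1
  ext i j
  fin_cases i <;> fin_cases j <;> simp [Matrix.mul_diagonal, Matrix.diagonal_mul] <;> ring

theorem skew_mem (hV : IsOrthogonalInvariant V) {A : Matrix (Fin 3) (Fin 3) ℝ}
    (hA : A ∈ V) (h : A 0 1 ≠ A 1 0) : !![0, 1, 0; -1, 0, 0; 0, 0, 0] ∈ V := by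
  have h₁ := hV.offDiag_mem hA
  have h₂ := hV.submatrix_mem h₁ (Equiv.swap 0 1)
  have hne : A 0 1 - A 1 0 ≠ 0 := sub_ne_zero.mpr h
  convert V.smul_mem (A 0 1 - A 1 0)⁻¹ (V.sub_mem h₁ h₂) using 1
  ext i j
  fin_cases i <;> fin_cases j <;> simp [Equiv.swap_apply_def] <;> field_simp <;> ring

theorem symm_mem (hV : IsOrthogonalInvariant V) {A : Matrix (Fin 3) (Fin 3) ℝ}
    (hA : A ∈ V) (h : A 0 1 + A 1 0 ≠ 0) : !![0, 1, 0; 1, 0, 0; 0, 0, 0] ∈ V := by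
  have h₁ := hV.offDiag_mem hA
  have h₂ := hV.submatrix_mem h₁ (Equiv.swap 0 1)
  convert V.smul_mem (A 0 1 + A 1 0)⁻¹ (V.add_mem h₁ h₂) using 1
  ext i j
  fin_cases i <;> fin_cases j <;> simp [Equiv.swap_apply_def] <;> field_simp <;> ring

theorem diag_mem (hV : IsOrthogonalInvariant V) {A : Matrix (Fin 3) (Fin 3) ℝ}
    (hA : A ∈ V) (h : A 0 0 ≠ A 1 1) : !![1, 0, 0; 0, -1, 0; 0, 0, 0] ∈ V := by
  have h₁ := hV.diagonal_diag_mem hA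
  have h₂ := hV.submatrix_mem h₁ (Equiv.swap 0 1)
  have hne : A 0 0 - A 1 1 ≠ 0 := sub_ne_zero.mpr h
  convert V.smul_mem (A 0 0 - A 1 1)⁻¹ (V.sub_mem h₁ h₂) using 1
  ext i j
  fin_cases i <;> fin_cases j <;>
    simp [Equiv.swap_apply_def] <;> field_simp <;> ring

theorem rotation_conj_mem (hV : IsOrthogonalInvariant V) {A : Matrix (Fin 3) (Fin 3) ℝ}
    (hA : A ∈ V) :
    !![3/5, -4/5, 0; 4/5, 3/5, 0; 0, 0, 1] * A * !![3/5, -4/5, 0; 4/5, 3/5, 0; 0, 0, 1]ᵀ ∈ V := by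
  refine hV A hA _ ?_
  ext i j
  fin_cases i <;> fin_cases j <;> simp [Matrix.mul_apply, Fin.sum_univ_three] <;> norm_num

theorem symm_mem_iff_diag_mem (hV : IsOrthogonalInvariant V) :
    !![0, 1, 0; 1, 0, 0; 0, 0, 0] ∈ V ↔ !![1, 0, 0; 0, -1, 0; 0, 0, 0] ∈ V := by
  constructor
  · intro h
    refine hV.diag_mem (hV.rotation_conj_mem h) ?_
    simp [Matrix.mul_apply, Fin.sum_univ_three]
    norm_num
  · intro h
    refine hV.symm_mem (hV.rotation_conj_mem h) ?_
    simp [Matrix.mul_apply, Fin.sum_univ_three]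
    norm_num

theorem so3_le (hV : IsOrthogonalInvariant V) {A : Matrix (Fin 3) (Fin 3) ℝ}
    (hA : A ∈ V) (h : Aᵀ ≠ A) : so3 ≤ V := by
  obtain ⟨i, j, hij⟩ : ∃ i j, A i j ≠ A j i := by
    contrapose! h
    ext i j
    exact h j i
  obtain ⟨σ, rfl, rfl⟩ := exists_perm_apply_zero_one (i := i) (j := j) (by rintro rfl; simp at hij)
  have hK := hV.skew_mem (hV.submatrix_mem hA σ) hij
  have hK₁ := hV.submatrix_mem hK (Equiv.swap 1 2)
  have hK₂ := hV.submatrix_mem hK (Equiv.swap 0 2)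
  intro B hB
  have hB' (i j) : B j i = -B i j := congrFun (congrFun (show Bᵀ = -B from hB) i) j
  convert V.add_mem (V.add_mem (V.smul_mem (B 0 1) hK) (V.smul_mem (B 0 2) hK₁))
    (V.smul_mem (-B 1 2) hK₂) using 1
  have h₀ := hB' 0 0
  have h₁ := hB' 1 1
  have h₂ := hB' 2 2
  ext i j
  fin_cases i <;> fin_cases j <;>
    simp [Equiv.swap_apply_def, hB' 0 1, hB' 0 2, hB' 1 2] <;> linarith

theorem sTL_le (hV : IsOrthogonalInvariant V) {A : Matrix (Fin 3) (Fin 3) ℝ}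
    (hA : A ∈ V) (htr : A.trace = 0) (h : Aᵀ ≠ -A) : sTL ≤ V := by
  have hS : !![0, 1, 0; 1, 0, 0; 0, 0, 0] ∈ V := by
    by_cases hoff : ∃ i j, i ≠ j ∧ A i j + A j i ≠ 0
    · obtain ⟨i, j, hne, hij⟩ := hoff
      obtain ⟨σ, rfl, rfl⟩ := exists_perm_apply_zero_one hne
      exact hV.symm_mem (hV.submatrix_mem hA σ) hij
    · push Not at hoff
      obtain ⟨i, j, hij⟩ : ∃ i j, A i i ≠ A j j := by
        contrapose! h
        rw [trace_fin_three] at htr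
        have h₁ := h 0 1
        have h₂ := h 0 2
        ext i j
        by_cases hne : i = j
        · subst hne
          have := h 0 i
          simp only [transpose_apply, Matrix.neg_apply]
          linarith
        · have := hoff i j hne
          simp only [transpose_apply, Matrix.neg_apply]
          linarith
      obtain ⟨σ, rfl, rfl⟩ :=
        exists_perm_apply_zero_one (i := i) (j := j) (by rintro rfl; simp at hij)
      exact hV.symm_mem_iff_diag_mem.mpr (hV.diag_mem (hV.submatrix_mem hA σ) hij)
  have hS₁ := hV.submatrix_mem hS (Equiv.swap 1 2)
  have hS₂ := hV.submatrix_mem hS (Equiv.swap 0 2)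
  have hD := hV.symm_mem_iff_diag_mem.mp hS
  have hD₂ := hV.submatrix_mem hD (Equiv.swap 0 2)
  rintro B ⟨hB, hBtr⟩
  have hB' (i j) : B j i = B i j := congrFun (congrFun hB i) j
  rw [trace_fin_three] at hBtr
  convert V.add_mem (V.add_mem (V.add_mem (V.add_mem (V.smul_mem (B 0 1) hS)
    (V.smul_mem (B 0 2) hS₁)) (V.smul_mem (B 1 2) hS₂)) (V.smul_mem (B 0 0) hD))
    (V.smul_mem (B 2 2) hD₂) using 1
  ext i j
  fin_cases i <;> fin_cases j <;>
    simp [Equiv.swap_apply_def, hB' 0 1, hB' 0 2, hB' 1 2] <;> linarith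

end IsOrthogonalInvariant

theorem sl3_le_so3_sup_sTL : sl3 ≤ so3 ⊔ sTL := by
  intro A hA
  have htr : A.trace = 0 := hA
  refine Submodule.mem_sup.mpr ⟨(1 / 2 : ℝ) • (A - Aᵀ), ?_, (1 / 2 : ℝ) • (A + Aᵀ), ⟨?_, ?_⟩, ?_⟩
  · change ((1 / 2 : ℝ) • (A - Aᵀ))ᵀ = -((1 / 2 : ℝ) • (A - Aᵀ))
    rw [transpose_smul, transpose_sub, transpose_transpose, ← smul_neg, neg_sub]
  · rw [transpose_smul, transpose_add, transpose_transpose, add_comm]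
  · simp [htr]
  · module

/-- Any subspace of `sl(3,ℝ)` invariant under conjugation by all orthogonal matrices is
`0`, `so(3)`, `𝔰`, or all of `sl(3,ℝ)`. -/
theorem stmt_5 (V : Submodule ℝ (Matrix (Fin 3) (Fin 3) ℝ))
    (hV : ∀ A ∈ V, A.trace = 0)
    (hinv : ∀ A ∈ V, ∀ q : Matrix (Fin 3) (Fin 3) ℝ, qᵀ * q = 1 → q * A * qᵀ ∈ V) :
    V = ⊥ ∨ V = so3 ∨ V = sTL ∨ V = sl3 := by
  have hV' : IsOrthogonalInvariant V := hinv
  by_cases hsymm : ∀ A ∈ V, Aᵀ = A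
  · by_cases hskew : ∀ A ∈ V, Aᵀ = -A
    · left
      refine (Submodule.eq_bot_iff V).mpr fun A hA => ?_
      ext i j
      have h := congrFun (congrFun ((hsymm A hA).symm.trans (hskew A hA)) i) j
      exact self_eq_neg.mp h
    · push Not at hskew
      obtain ⟨A, hA, h⟩ := hskew
      right; right; left
      exact le_antisymm (fun B hB => ⟨hsymm B hB, hV B hB⟩) (hV'.sTL_le hA (hV A hA) h)
  · push Not at hsymm
    obtain ⟨A, hA, h⟩ := hsymm
    have hso := hV'.so3_le hA h
    right
    by_cases hskew : ∀ A ∈ V, Aᵀ = -A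
    · exact Or.inl (le_antisymm hskew hso)
    · push Not at hskew
      obtain ⟨B, hB, h'⟩ := hskew
      right; right
      exact le_antisymm hV
        (sl3_le_so3_sup_sTL.trans (sup_le hso (hV'.sTL_le hB (hV B hB) h')))
end
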